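/- Consider the curved 2-body problem in S³ with two equal masses m > 0 and a candidate of positive elliptic-elliptic form q_1 = (r cos α, r sin α, ρ cos β, ρ sin β), q_2 = (r cos(α+π), r sin(α+π), ρ cos β, ρ sin β), with ρ := (1 − r²)^{1/2}, 0 < r(t) < 1, and α, β nonconstant. Then (q_1, q_2) solves the equations of motion in S³ if and only if there exist constants c_1, c_2 ≠ 0 such that α̇ = c_1/(2 m r²), β̇ = c_2/(2 m (1 − r²)), and r̈ = r(1 − r²)[c_1²/(4 m² r⁴) − c_2²/(4 m² (1 − r²)²)] − r ṙ²/(1 − r²) − m/(4 r² (1 − r²)^{1/2}). Moreover, for every such solution the total angular momenta relative to the wy-, wz-, xy-, and xz-planes vanish: Σ_{i=1}^2 m (w_i ẏ_i − ẇ_i y_i) = Σ_{i=1}^2 m (w_i ż_i − ẇ_i z_i) = Σ_{i=1}^2 m (x_i ẏ_i − ẋ_i y_i) = Σ_{i=1}^2 m (x_i ż_i − ẋ_i z_i) = 0. -/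

import Mathlib

open Real Finset

/-- The first derivative of the Cartesian coordinate `s cos (θ + c)`. -/
lemma hasDerivAt_mul_cos_add {s θ : ℝ → ℝ} {s' θ' t : ℝ} (hs : HasDerivAt s s' t)
    (hθ : HasDerivAt θ θ' t) (c : ℝ) :
    HasDerivAt (fun u => s u * cos (θ u + c))
      (s' * cos (θ t + c) - s t * θ' * sin (θ t + c)) t :=
  (hs.mul (hθ.add_const c).cos).congr_deriv (by ring)

/-- The first derivative of the Cartesian coordinate `s sin (θ + c)`. -/
lemma hasDerivAt_mul_sin_add {s θ : ℝ → ℝ} {s' θ' t : ℝ} (hs : HasDerivAt s s' t)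
    (hθ : HasDerivAt θ θ' t) (c : ℝ) :
    HasDerivAt (fun u => s u * sin (θ u + c))
      (s' * sin (θ t + c) + s t * θ' * cos (θ t + c)) t :=
  (hs.mul (hθ.add_const c).sin).congr_deriv (by ring)

lemma hasDerivAt_of_contDiff_two {f : ℝ → ℝ} (hf : ContDiff ℝ 2 f) (t : ℝ) :
    HasDerivAt f (deriv f t) t :=
  (hf.differentiable (by norm_num) t).hasDerivAt

lemma hasDerivAt_deriv_of_contDiff_two {f : ℝ → ℝ} (hf : ContDiff ℝ 2 f) (t : ℝ) :
    HasDerivAt (deriv f) (deriv (deriv f) t) t :=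
  (((contDiff_succ_iff_deriv (n := 1)).1 hf).2.2.differentiable (by norm_num) t).hasDerivAt

/-- The acceleration of a curve in polar coordinates, first Cartesian component. -/
lemma deriv_deriv_mul_cos_add {s θ : ℝ → ℝ} (hs : ContDiff ℝ 2 s) (hθ : ContDiff ℝ 2 θ)
    (c t : ℝ) :
    deriv (deriv fun u => s u * cos (θ u + c)) t =
      (deriv (deriv s) t - s t * deriv θ t ^ 2) * cos (θ t + c)
        - (2 * deriv s t * deriv θ t + s t * deriv (deriv θ) t) * sin (θ t + c) := by
  have hs₁ := hasDerivAt_of_contDiff_two hs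
  have hθ₁ := hasDerivAt_of_contDiff_two hθ
  have h : (deriv fun u => s u * cos (θ u + c)) = fun u =>
      deriv s u * cos (θ u + c) - s u * deriv θ u * sin (θ u + c) :=
    funext fun u => (hasDerivAt_mul_cos_add (hs₁ u) (hθ₁ u) c).deriv
  rw [h]
  refine HasDerivAt.deriv (((hasDerivAt_mul_cos_add (hasDerivAt_deriv_of_contDiff_two hs t)
    (hθ₁ t) c).sub (hasDerivAt_mul_sin_add
      ((hs₁ t).mul (hasDerivAt_deriv_of_contDiff_two hθ t)) (hθ₁ t) c)).congr_deriv ?_)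
  simp only [Pi.mul_apply]
  ring

/-- The acceleration of a curve in polar coordinates, second Cartesian component. -/
lemma deriv_deriv_mul_sin_add {s θ : ℝ → ℝ} (hs : ContDiff ℝ 2 s) (hθ : ContDiff ℝ 2 θ)
    (c t : ℝ) :
    deriv (deriv fun u => s u * sin (θ u + c)) t =
      (deriv (deriv s) t - s t * deriv θ t ^ 2) * sin (θ t + c)
        + (2 * deriv s t * deriv θ t + s t * deriv (deriv θ) t) * cos (θ t + c) := by
  have h := deriv_deriv_mul_cos_add hs hθ (c - π / 2) t
  simpa only [← add_sub_assoc, cos_sub_pi_div_two, sin_sub_pi_div_two, mul_neg,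
    sub_neg_eq_add] using h

/-- A planar curve in polar coordinates satisfies `f'' = l f` at a given time iff its radial and
transversal accelerations are `l s` and `0`. -/
lemma deriv_deriv_polar_eq_mul_iff {s θ : ℝ → ℝ} (hs : ContDiff ℝ 2 s) (hθ : ContDiff ℝ 2 θ)
    (c l t : ℝ) :
    (deriv (deriv fun u => s u * cos (θ u + c)) t = l * (s t * cos (θ t + c)) ∧
      deriv (deriv fun u => s u * sin (θ u + c)) t = l * (s t * sin (θ t + c))) ↔
    (deriv (deriv s) t - s t * deriv θ t ^ 2 = l * s t ∧
      2 * deriv s t * deriv θ t + s t * deriv (deriv θ) t = 0) := by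
  rw [deriv_deriv_mul_cos_add hs hθ, deriv_deriv_mul_sin_add hs hθ]
  generalize deriv (deriv s) t - s t * deriv θ t ^ 2 = A
  generalize 2 * deriv s t * deriv θ t + s t * deriv (deriv θ) t = B
  have h := sin_sq_add_cos_sq (θ t + c)
  constructor
  · rintro ⟨h₁, h₂⟩
    constructor
    · linear_combination cos (θ t + c) * h₁ + sin (θ t + c) * h₂ - (A - l * s t) * h
    · linear_combination cos (θ t + c) * h₂ - sin (θ t + c) * h₁ - B * h
  · rintro ⟨rfl, rfl⟩
    constructor <;> ring

/-- The transversal acceleration of a planar curve vanishes iff its areal velocity is constant. -/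
lemma transversal_eq_zero_iff {s θ : ℝ → ℝ} (hs : ContDiff ℝ 2 s) (hθ : ContDiff ℝ 2 θ)
    (hpos : ∀ t, 0 < s t) {k : ℝ} (hk : k ≠ 0) :
    (∀ t, 2 * deriv s t * deriv θ t + s t * deriv (deriv θ) t = 0) ↔
      ∃ c, ∀ t, deriv θ t = c / (k * s t ^ 2) := by
  have hd (t : ℝ) : HasDerivAt (fun u => s u ^ 2 * deriv θ u)
      (s t * (2 * deriv s t * deriv θ t + s t * deriv (deriv θ) t)) t := by
    refine (((hasDerivAt_of_contDiff_two hs t).pow 2).mul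
      (hasDerivAt_deriv_of_contDiff_two hθ t)).congr_deriv ?_
    simp only [Pi.pow_apply]
    push_cast
    ring
  constructor
  · intro h
    refine ⟨k * (s 0 ^ 2 * deriv θ 0), fun t => ?_⟩
    have hc : s t ^ 2 * deriv θ t = s 0 ^ 2 * deriv θ 0 :=
      is_const_of_deriv_eq_zero (fun u => (hd u).differentiableAt)
        (fun u => by rw [(hd u).deriv, h, mul_zero]) t 0
    have := (hpos t).ne'
    rw [← hc]
    field_simp
  · rintro ⟨c, h⟩ t
    have hc : (fun u => s u ^ 2 * deriv θ u) = fun _ => c / k := funext fun u => by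
      have := (hpos u).ne'
      rw [h]
      field_simp
    have h₀ := (hd t).unique (hc ▸ hasDerivAt_const t (c / k))
    exact (mul_eq_zero.1 h₀).resolve_left (hpos t).ne'

/-- A nonconstant differentiable function has no identically zero derivative. -/
lemma ne_zero_of_deriv_eq_div {θ d : ℝ → ℝ} {c : ℝ} (hθ : Differentiable ℝ θ)
    (hnc : ∃ t₁ t₂, θ t₁ ≠ θ t₂) (h : ∀ t, deriv θ t = c / d t) : c ≠ 0 := by
  rintro rfl
  obtain ⟨t₁, t₂, hne⟩ := hnc
  exact hne (is_const_of_deriv_eq_zero hθ (fun t => by rw [h, zero_div]) t₁ t₂)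

/-- First and second derivatives of the relation `r² + ρ² = 1`. -/
lemma deriv_relations_of_sq_add_sq_eq_one {r ρ : ℝ → ℝ} (hr : ContDiff ℝ 2 r)
    (hρ : ContDiff ℝ 2 ρ) (h : ∀ t, r t ^ 2 + ρ t ^ 2 = 1) (t : ℝ) :
    r t * deriv r t + ρ t * deriv ρ t = 0 ∧
      deriv r t ^ 2 + r t * deriv (deriv r) t
        + (deriv ρ t ^ 2 + ρ t * deriv (deriv ρ) t) = 0 := by
  have hr₁ := hasDerivAt_of_contDiff_two hr
  have hρ₁ := hasDerivAt_of_contDiff_two hρ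
  have h₁ (u : ℝ) : r u * deriv r u + ρ u * deriv ρ u = 0 := by
    have hc : r ^ 2 + ρ ^ 2 = fun _ => (1 : ℝ) := funext h
    have h₀ := (((hr₁ u).pow 2).add ((hρ₁ u).pow 2)).unique (hc ▸ hasDerivAt_const u (1 : ℝ))
    push_cast at h₀
    linear_combination h₀ / 2
  refine ⟨h₁ t, ?_⟩
  have hc : r * deriv r + ρ * deriv ρ = fun _ => (0 : ℝ) := funext h₁
  have h₀ := (((hr₁ t).mul (hasDerivAt_deriv_of_contDiff_two hr t)).add
    ((hρ₁ t).mul (hasDerivAt_deriv_of_contDiff_two hρ t))).unique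
      (hc ▸ hasDerivAt_const t (0 : ℝ))
  linear_combination h₀

/-- On `r² + ρ² = 1`, with `A`, `B` the angular velocities, the two radial equations of motion
are both equivalent to a single second-order equation for `r`. -/
lemma radial_equations_iff {m r ρ r₁ r₂ ρ₁ ρ₂ A B : ℝ} (hr : 0 < r) (hρ : 0 < ρ)
    (h : r ^ 2 + ρ ^ 2 = 1) (h₁ : r * r₁ + ρ * ρ₁ = 0)
    (h₂ : r₁ ^ 2 + r * r₂ + (ρ₁ ^ 2 + ρ * ρ₂) = 0) :
    (r₂ - r * A ^ 2 = (-(m / (4 * r ^ 3 * ρ)) -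
        (r₁ ^ 2 + (r * A) ^ 2 + ρ₁ ^ 2 + (ρ * B) ^ 2)) * r ∧
      ρ₂ - ρ * B ^ 2 = (m / (4 * r * ρ ^ 3) -
        (r₁ ^ 2 + (r * A) ^ 2 + ρ₁ ^ 2 + (ρ * B) ^ 2)) * ρ) ↔
    r₂ = r * ρ ^ 2 * (A ^ 2 - B ^ 2) - r * r₁ ^ 2 / ρ ^ 2 - m / (4 * r ^ 2 * ρ) := by
  have hr₀ := hr.ne'
  have hρ₀ := hρ.ne'
  have hK : r₁ ^ 2 + ρ₁ ^ 2 = r₁ ^ 2 / ρ ^ 2 := by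
    rw [eq_div_iff (by positivity)]
    linear_combination r₁ ^ 2 * h + (ρ * ρ₁ - r * r₁) * h₁
  have hm₁ : m / (4 * r ^ 3 * ρ) * r = m / (4 * r ^ 2 * ρ) := by field_simp
  have hm₂ : m / (4 * r * ρ ^ 3) * ρ ^ 2 = m / (4 * r ^ 2 * ρ) * r := by field_simp
  have hd : r * r₁ ^ 2 / ρ ^ 2 = r * (r₁ ^ 2 / ρ ^ 2) := mul_div_assoc _ _ _
  rw [hd, ← hK]
  constructor
  · rintro ⟨h₃, -⟩
    linear_combination h₃ - hm₁ - r * A ^ 2 * h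
  · intro h₃
    have h₄ : r₂ - r * A ^ 2 = (-(m / (4 * r ^ 3 * ρ)) -
        (r₁ ^ 2 + (r * A) ^ 2 + ρ₁ ^ 2 + (ρ * B) ^ 2)) * r := by
      linear_combination h₃ + hm₁ + r * A ^ 2 * h
    refine ⟨h₄, mul_left_cancel₀ hρ₀ ?_⟩
    linear_combination h₂ - r * h₄ + r * hm₁ - hm₂ +
      (r₁ ^ 2 + (r * A) ^ 2 + ρ₁ ^ 2 + (ρ * B) ^ 2) * h

/-- Positive elliptic-elliptic rotopulsators of the 2-body problem in S³. -/
theorem positive_elliptic_elliptic_two_body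
    (m : ℝ) (hm : 0 < m)
    (a : Fin 2 → ℝ) (ha : a = ![0, π])
    (α β r ρ : ℝ → ℝ)
    (hαC : ContDiff ℝ 2 α) (hβC : ContDiff ℝ 2 β) (hrC : ContDiff ℝ 2 r)
    (hαnc : ∃ t₁ t₂, α t₁ ≠ α t₂) (hβnc : ∃ t₁ t₂, β t₁ ≠ β t₂)
    (hρ : ∀ t, ρ t = Real.sqrt (1 - r t ^ 2))
    (hrpos : ∀ t, 0 < r t) (hrlt : ∀ t, r t < 1)
    (w x Y Z : Fin 2 → ℝ → ℝ)
    (hw : ∀ i t, w i t = r t * cos (α t + a i))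
    (hx : ∀ i t, x i t = r t * sin (α t + a i))
    (hY : ∀ i t, Y i t = ρ t * cos (β t))
    (hZ : ∀ i t, Z i t = ρ t * sin (β t))
    (q : Fin 2 → Fin 2 → ℝ → ℝ)
    (hq : ∀ i j t, q i j t =
      w i t * w j t + x i t * x j t + Y i t * Y j t + Z i t * Z j t)
    (hreg : ∀ i j, i ≠ j → ∀ t, q i j t ^ 2 ≠ 1) :
    ((∀ f : Fin 2 → ℝ → ℝ, (f = w ∨ f = x ∨ f = Y ∨ f = Z) → ∀ i t,
        deriv (deriv (f i)) t =
          (∑ j ∈ Finset.univ.erase i,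
            m * (f j t - q i j t * f i t) / (1 - q i j t ^ 2) ^ ((3:ℝ)/2))
          - (deriv (w i) t ^ 2 + deriv (x i) t ^ 2 + deriv (Y i) t ^ 2
              + deriv (Z i) t ^ 2) * f i t)
      ↔
      (∃ c₁ c₂ : ℝ, c₁ ≠ 0 ∧ c₂ ≠ 0 ∧
        (∀ t, deriv α t = c₁ / (2 * m * r t ^ 2)) ∧
        (∀ t, deriv β t = c₂ / (2 * m * (1 - r t ^ 2))) ∧
        (∀ t, deriv (deriv r) t =
          r t * (1 - r t ^ 2) * (c₁ ^ 2 / (4 * m ^ 2 * r t ^ 4)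
              - c₂ ^ 2 / (4 * m ^ 2 * (1 - r t ^ 2) ^ 2))
          - r t * deriv r t ^ 2 / (1 - r t ^ 2)
          - m / (4 * r t ^ 2 * Real.sqrt (1 - r t ^ 2))))) ∧
    -- moreover, for every such solution the angular momenta relative to the
    -- wy-, wz-, xy-, xz-planes vanish
    ((∀ f : Fin 2 → ℝ → ℝ, (f = w ∨ f = x ∨ f = Y ∨ f = Z) → ∀ i t,
        deriv (deriv (f i)) t =
          (∑ j ∈ Finset.univ.erase i,
            m * (f j t - q i j t * f i t) / (1 - q i j t ^ 2) ^ ((3:ℝ)/2))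
          - (deriv (w i) t ^ 2 + deriv (x i) t ^ 2 + deriv (Y i) t ^ 2
              + deriv (Z i) t ^ 2) * f i t) →
      ∀ t,
        (∑ i, m * (w i t * deriv (Y i) t - deriv (w i) t * Y i t) = 0) ∧
        (∑ i, m * (w i t * deriv (Z i) t - deriv (w i) t * Z i t) = 0) ∧
        (∑ i, m * (x i t * deriv (Y i) t - deriv (x i) t * Y i t) = 0) ∧
        (∑ i, m * (x i t * deriv (Z i) t - deriv (x i) t * Z i t) = 0)) := by
  have hρpos (t : ℝ) : 0 < ρ t := by
    rw [hρ]
    exact Real.sqrt_pos.2 (by nlinarith [hrpos t, hrlt t])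
  have hone (t : ℝ) : r t ^ 2 + ρ t ^ 2 = 1 := by
    rw [hρ, Real.sq_sqrt (by nlinarith [hrpos t, hrlt t])]
    ring
  have hρC : ContDiff ℝ 2 ρ := by
    rw [funext hρ]
    exact (contDiff_const.sub (hrC.pow 2)).sqrt
      fun t => (by nlinarith [hrpos t, hrlt t] : 0 < 1 - r t ^ 2).ne'
  have hwf (i : Fin 2) : w i = fun t => r t * cos (α t + a i) := funext (hw i)
  have hxf (i : Fin 2) : x i = fun t => r t * sin (α t + a i) := funext (hx i)
  have hYf (i : Fin 2) : Y i = fun t => ρ t * cos (β t + 0) := by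
    simpa only [add_zero] using funext (hY i)
  have hZf (i : Fin 2) : Z i = fun t => ρ t * sin (β t + 0) := by
    simpa only [add_zero] using funext (hZ i)
  have hw' (i : Fin 2) : w i.rev = -w i := by
    ext t
    fin_cases i <;> simp [hw, ha]
  have hx' (i : Fin 2) : x i.rev = -x i := by
    ext t
    fin_cases i <;> simp [hx, ha]
  have hY' (i : Fin 2) : Y i.rev = Y i := by rw [hYf, hYf]
  have hZ' (i : Fin 2) : Z i.rev = Z i := by rw [hZf, hZf]
  have herase (i : Fin 2) : Finset.univ.erase i = {i.rev} := by
    revert i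
    decide
  have hq' (i : Fin 2) (t : ℝ) : q i i.rev t = 1 - 2 * r t ^ 2 := by
    rw [hq, hw', hx', hY', hZ', Pi.neg_apply, Pi.neg_apply, hw, hx, hY, hZ]
    linear_combination (-r t ^ 2) * sin_sq_add_cos_sq (α t + a i) +
      ρ t ^ 2 * sin_sq_add_cos_sq (β t) + hone t
  have hden (i : Fin 2) (t : ℝ) :
      (1 - q i i.rev t ^ 2) ^ ((3 : ℝ) / 2) = (2 * r t * ρ t) ^ 3 := by
    have h0 : 0 ≤ 2 * r t * ρ t := by
      have := hrpos t
      have := hρpos t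
      positivity
    have h1 : 1 - q i i.rev t ^ 2 = (2 * r t * ρ t) ^ (2 : ℝ) := by
      rw [hq', Real.rpow_two]
      linear_combination (-4 * r t ^ 2) * hone t
    rw [h1, ← Real.rpow_mul h0, ← Real.rpow_natCast]
    norm_num
  have hforce_neg (f : Fin 2 → ℝ → ℝ) (i : Fin 2) (t : ℝ) (hf : f i.rev = -f i) :
      ∑ j ∈ Finset.univ.erase i,
        m * (f j t - q i j t * f i t) / (1 - q i j t ^ 2) ^ ((3 : ℝ) / 2) =
      -(m / (4 * r t ^ 3 * ρ t)) * f i t := by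
    have hr₀ := (hrpos t).ne'
    have hρ₀ := (hρpos t).ne'
    rw [herase, Finset.sum_singleton, hden, hq', hf, Pi.neg_apply,
      show -f i t - (1 - 2 * r t ^ 2) * f i t = -2 * ρ t ^ 2 * f i t by
        linear_combination (2 * f i t) * hone t]
    field_simp
    ring
  have hforce_pos (f : Fin 2 → ℝ → ℝ) (i : Fin 2) (t : ℝ) (hf : f i.rev = f i) :
      ∑ j ∈ Finset.univ.erase i,
        m * (f j t - q i j t * f i t) / (1 - q i j t ^ 2) ^ ((3 : ℝ) / 2) =
      m / (4 * r t * ρ t ^ 3) * f i t := by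
    have hr₀ := (hrpos t).ne'
    have hρ₀ := (hρpos t).ne'
    rw [herase, Finset.sum_singleton, hden, hq', hf,
      show f i t - (1 - 2 * r t ^ 2) * f i t = 2 * r t ^ 2 * f i t by ring]
    field_simp
    ring
  have hα₁ := hasDerivAt_of_contDiff_two hαC
  have hβ₁ := hasDerivAt_of_contDiff_two hβC
  have hr₁ := hasDerivAt_of_contDiff_two hrC
  have hρ₁ := hasDerivAt_of_contDiff_two hρC
  have hkin (i : Fin 2) (t : ℝ) :
      deriv (w i) t ^ 2 + deriv (x i) t ^ 2 + deriv (Y i) t ^ 2 + deriv (Z i) t ^ 2 =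
      deriv r t ^ 2 + (r t * deriv α t) ^ 2 + deriv ρ t ^ 2 + (ρ t * deriv β t) ^ 2 := by
    rw [hwf, hxf, hYf, hZf, (hasDerivAt_mul_cos_add (hr₁ t) (hα₁ t) (a i)).deriv,
      (hasDerivAt_mul_sin_add (hr₁ t) (hα₁ t) (a i)).deriv,
      (hasDerivAt_mul_cos_add (hρ₁ t) (hβ₁ t) 0).deriv,
      (hasDerivAt_mul_sin_add (hρ₁ t) (hβ₁ t) 0).deriv]
    linear_combination
      (deriv r t ^ 2 + (r t * deriv α t) ^ 2) * sin_sq_add_cos_sq (α t + a i) +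
      (deriv ρ t ^ 2 + (ρ t * deriv β t) ^ 2) * sin_sq_add_cos_sq (β t + 0)
  refine ⟨?_, fun _ t => ?_⟩
  · have hpt (i : Fin 2) (t : ℝ) :
        (∀ f : Fin 2 → ℝ → ℝ, (f = w ∨ f = x ∨ f = Y ∨ f = Z) →
          deriv (deriv (f i)) t =
            (∑ j ∈ Finset.univ.erase i,
              m * (f j t - q i j t * f i t) / (1 - q i j t ^ 2) ^ ((3 : ℝ) / 2))
            - (deriv (w i) t ^ 2 + deriv (x i) t ^ 2 + deriv (Y i) t ^ 2
                + deriv (Z i) t ^ 2) * f i t) ↔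
        deriv (deriv r) t = r t * ρ t ^ 2 * (deriv α t ^ 2 - deriv β t ^ 2)
            - r t * deriv r t ^ 2 / ρ t ^ 2 - m / (4 * r t ^ 2 * ρ t) ∧
          2 * deriv r t * deriv α t + r t * deriv (deriv α) t = 0 ∧
          2 * deriv ρ t * deriv β t + ρ t * deriv (deriv β) t = 0 := by
      obtain ⟨h₁, h₂⟩ := deriv_relations_of_sq_add_sq_eq_one hrC hρC hone t
      simp only [forall_eq_or_imp, forall_eq]
      rw [hforce_neg w i t (hw' i), hforce_neg x i t (hx' i), hforce_pos Y i t (hY' i),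
        hforce_pos Z i t (hZ' i), hkin, ← sub_mul, ← sub_mul, ← sub_mul, ← sub_mul, ← and_assoc,
        hwf, hxf, hYf, hZf, deriv_deriv_polar_eq_mul_iff hrC hαC,
        deriv_deriv_polar_eq_mul_iff hρC hβC,
        ← radial_equations_iff (hrpos t) (hρpos t) (hone t) h₁ h₂]
      tauto
    have hall : (∀ f : Fin 2 → ℝ → ℝ, (f = w ∨ f = x ∨ f = Y ∨ f = Z) → ∀ i t,
        deriv (deriv (f i)) t =
          (∑ j ∈ Finset.univ.erase i,
            m * (f j t - q i j t * f i t) / (1 - q i j t ^ 2) ^ ((3 : ℝ) / 2))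
          - (deriv (w i) t ^ 2 + deriv (x i) t ^ 2 + deriv (Y i) t ^ 2
              + deriv (Z i) t ^ 2) * f i t) ↔
        (∀ t, deriv (deriv r) t = r t * ρ t ^ 2 * (deriv α t ^ 2 - deriv β t ^ 2)
            - r t * deriv r t ^ 2 / ρ t ^ 2 - m / (4 * r t ^ 2 * ρ t)) ∧
          (∀ t, 2 * deriv r t * deriv α t + r t * deriv (deriv α) t = 0) ∧
          ∀ t, 2 * deriv ρ t * deriv β t + ρ t * deriv (deriv β) t = 0 := by
      rw [← forall_and, ← forall_and]
      exact ⟨fun h t => (hpt 0 t).1 fun f hf => h f hf 0 t,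
        fun h f hf i t => (hpt i t).2 (h t) f hf⟩
    have hk : 2 * m ≠ 0 := by positivity
    rw [hall, transversal_eq_zero_iff hrC hαC hrpos hk,
      transversal_eq_zero_iff hρC hβC hρpos hk]
    have hρsq (t : ℝ) : 1 - r t ^ 2 = ρ t ^ 2 := by linear_combination -hone t
    simp only [← hρ]
    simp only [hρsq]
    have hrad (c₁ c₂ t : ℝ) (h₁ : deriv α t = c₁ / (2 * m * r t ^ 2))
        (h₂ : deriv β t = c₂ / (2 * m * ρ t ^ 2)) :
        c₁ ^ 2 / (4 * m ^ 2 * r t ^ 4) - c₂ ^ 2 / (4 * m ^ 2 * (ρ t ^ 2) ^ 2) =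
          deriv α t ^ 2 - deriv β t ^ 2 := by
      rw [h₁, h₂, div_pow, div_pow]
      ring_nf
    constructor
    · rintro ⟨h, ⟨c₁, h₁⟩, ⟨c₂, h₂⟩⟩
      refine ⟨c₁, c₂, ne_zero_of_deriv_eq_div (hαC.differentiable (by norm_num)) hαnc h₁,
        ne_zero_of_deriv_eq_div (hβC.differentiable (by norm_num)) hβnc h₂, h₁, h₂,
        fun t => ?_⟩
      rw [hrad c₁ c₂ t (h₁ t) (h₂ t), h t]
    · rintro ⟨c₁, c₂, -, -, h₁, h₂, h⟩
      refine ⟨fun t => ?_, ⟨c₁, h₁⟩, ⟨c₂, h₂⟩⟩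
      rw [h t, hrad c₁ c₂ t (h₁ t) (h₂ t)]
  · have hw₁ : w 1 = -w 0 := hw' 0
    have hx₁ : x 1 = -x 0 := hx' 0
    have hY₁ : Y 1 = Y 0 := hY' 0
    have hZ₁ : Z 1 = Z 0 := hZ' 0
    simp only [Fin.sum_univ_two, hw₁, hx₁, hY₁, hZ₁, deriv.neg, Pi.neg_apply]
    refine ⟨?_, ?_, ?_, ?_⟩ <;> ring
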